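/- arXiv:1706.03180 — 7 statements merged into one kernel-verified Lean document; each statement's English description precedes it below -/
import Mathlib

section
/- For every integer n ≥ 2, the monoid B_n = ⟨a, b | ba = b^n⟩ has the following properties: every element of B_n can be written in the form a^k b^m with k, m ∈ ℕ₀, and multiplication is given by a^k b^m · a^r b^s = a^{k+r} b^s if m = 0 and a^k b^m · a^r b^s = a^k b^{m+(n−1)r+s} if m > 0; moreover B_n is reduced, unit-cancellative, right-cancellative but not left-cancellative, and atomic with set of atoms A(B_n) = {a, b}. -/
/-- An atom (irreducible element) of a monoid: a non-unit `u` such that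
`u = b * c` implies that `b` or `c` is a unit. -/
def IsMonAtom {M : Type*} [Monoid M] (u : M) : Prop :=
  ¬ IsUnit u ∧ ∀ b c : M, u = b * c → IsUnit b ∨ IsUnit c

/-- A monoid is reduced if its only invertible element is `1`. -/
def MonReduced (M : Type*) [Monoid M] : Prop := ∀ u : M, IsUnit u → u = 1

/-- A monoid is (left and right) unit-cancellative if `a = a * u` or `a = u * a`
implies that `u` is a unit. -/
def UnitCancellative (M : Type*) [Monoid M] : Prop :=
  (∀ a u : M, a * u = a → IsUnit u) ∧ (∀ a u : M, u * a = a → IsUnit u)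

/-- A monoid is atomic if every non-unit is a finite product of atoms. -/
def MonAtomic (M : Type*) [Monoid M] : Prop :=
  ∀ a : M, ¬ IsUnit a → ∃ l : List M, (∀ u ∈ l, IsMonAtom u) ∧ l.prod = a

attribute [local instance] Classical.propDecidable

/-- The set of lengths `L(a)` of an element: the set of all `k ∈ ℕ` such that `a`
is a product of `k` atoms, with the convention `L(1) = {0}`. -/
noncomputable def setOfLengths {M : Type*} [Monoid M] (x : M) : Set ℕ :=
  if x = 1 then {0}
  else {k | ∃ l : List M, l.length = k ∧ (∀ u ∈ l, IsMonAtom u) ∧ l.prod = x}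

/-- The system of sets of lengths `𝓛(M) = {L(a) : a ∈ M}`. -/
def LSystem (M : Type*) [Monoid M] : Set (Set ℕ) :=
  Set.range (setOfLengths (M := M))

/-- `U_k(M)`, the union of all sets of lengths containing `k`. -/
def unionOfLengths (M : Type*) [Monoid M] (k : ℕ) : Set ℕ :=
  ⋃₀ {L | L ∈ LSystem M ∧ k ∈ L}
/-- The defining relation `b * a = b ^ n` of the monoid `B_n`, on the free
monoid over two generators (`0` stands for `a`, `1` stands for `b`). -/
def BnRel (n : ℕ) : FreeMonoid (Fin 2) → FreeMonoid (Fin 2) → Prop := fun x y =>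
  x = FreeMonoid.of 1 * FreeMonoid.of 0 ∧ y = FreeMonoid.of 1 ^ n

/-- The congruence on the free monoid generated by the relation `b * a = b ^ n`. -/
def BnCon (n : ℕ) : Con (FreeMonoid (Fin 2)) := conGen (BnRel n)

/-- The monoid `B_n = ⟨ a, b ∣ b * a = b ^ n ⟩`. -/
abbrev Bn (n : ℕ) := (BnCon n).Quotient

/-- The generator `a` of `B_n`. -/
def bA (n : ℕ) : Bn n := (BnCon n).mk' (FreeMonoid.of 0)

/-- The generator `b` of `B_n`. -/
def bB (n : ℕ) : Bn n := (BnCon n).mk' (FreeMonoid.of 1)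

/-- The monoid of normal forms `a ^ k * b ^ m`, recorded by the exponents `(k, m)`, where moving
`a` to the left past a nontrivial power of `b` turns it into `b ^ c`. -/
@[ext] structure BnNormalForm (c : ℕ) where
  /-- The exponent of `a`. -/
  expA : ℕ
  /-- The exponent of `b`. -/
  expB : ℕ

namespace BnNormalForm

variable {c : ℕ}

instance : One (BnNormalForm c) := ⟨⟨0, 0⟩⟩

instance : Mul (BnNormalForm c) :=
  ⟨fun x y => if x.expB = 0 then ⟨x.expA + y.expA, y.expB⟩
    else ⟨x.expA, x.expB + c * y.expA + y.expB⟩⟩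

theorem one_def : (1 : BnNormalForm c) = ⟨0, 0⟩ := rfl

theorem mk_mul_mk (k m r s : ℕ) : (⟨k, m⟩ * ⟨r, s⟩ : BnNormalForm c) =
    if m = 0 then ⟨k + r, s⟩ else ⟨k, m + c * r + s⟩ := rfl

instance : Monoid (BnNormalForm c) where
  mul_assoc := by
    rintro ⟨k, m⟩ ⟨r, s⟩ ⟨t, u⟩
    rcases Nat.eq_zero_or_pos m with rfl | hm <;> rcases Nat.eq_zero_or_pos s with rfl | hs
    · simp [mk_mul_mk, add_assoc]
    · simp [mk_mul_mk, hs.ne']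
    · simp [mk_mul_mk, hm.ne', mul_add, add_assoc]
    · simp [mk_mul_mk, hm.ne', hs.ne', add_assoc]
  one_mul := by
    rintro ⟨k, m⟩
    simp [one_def, mk_mul_mk]
  mul_one := by
    rintro ⟨k, m⟩
    by_cases hm : m = 0 <;> simp [one_def, mk_mul_mk, hm]

theorem mk_one_zero_pow (k : ℕ) : (⟨1, 0⟩ : BnNormalForm c) ^ k = ⟨k, 0⟩ := by
  induction k with
  | zero => rfl
  | succ k ih => rw [pow_succ, ih, mk_mul_mk, if_pos rfl]

theorem mk_zero_one_pow (m : ℕ) : (⟨0, 1⟩ : BnNormalForm c) ^ m = ⟨0, m⟩ := by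
  induction m with
  | zero => rfl
  | succ m ih =>
    rw [pow_succ, ih, mk_mul_mk]
    split_ifs with h <;> simp [h]

end BnNormalForm

theorem bB_mul_bA (n : ℕ) : bB n * bA n = bB n ^ n := by
  have h : BnCon n (FreeMonoid.of 1 * FreeMonoid.of 0) (FreeMonoid.of 1 ^ n) :=
    ConGen.Rel.of _ _ ⟨rfl, rfl⟩
  rw [bA, bB, ← map_mul, ← map_pow]
  exact (BnCon n).eq.mpr h

/-- The homomorphism from `B_{c+1}` reading off the exponents of the normal form. -/
def bnToNormalForm (c : ℕ) : Bn (c + 1) →* BnNormalForm c :=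
  (BnCon (c + 1)).lift (FreeMonoid.lift ![⟨1, 0⟩, ⟨0, 1⟩]) <| by
    refine Con.conGen_le.mpr ?_
    rintro _ _ ⟨rfl, rfl⟩
    simp [Con.ker_rel, BnNormalForm.mk_zero_one_pow, BnNormalForm.mk_mul_mk, add_comm]

theorem bnToNormalForm_bA (c : ℕ) : bnToNormalForm c (bA (c + 1)) = ⟨1, 0⟩ := rfl

theorem bnToNormalForm_bB (c : ℕ) : bnToNormalForm c (bB (c + 1)) = ⟨0, 1⟩ := rfl

theorem bnToNormalForm_pow_mul_pow (c k m : ℕ) :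
    bnToNormalForm c (bA (c + 1) ^ k * bB (c + 1) ^ m) = ⟨k, m⟩ := by
  simp [bnToNormalForm_bA, bnToNormalForm_bB, BnNormalForm.mk_one_zero_pow,
    BnNormalForm.mk_zero_one_pow, BnNormalForm.mk_mul_mk]

theorem bA_pow_mul_bB_pow_inj {n : ℕ} (hn : 1 ≤ n) {k m r s : ℕ} :
    bA n ^ k * bB n ^ m = bA n ^ r * bB n ^ s ↔ k = r ∧ m = s := by
  obtain ⟨c, rfl⟩ := Nat.exists_eq_add_of_le' hn
  refine ⟨fun h => ?_, by rintro ⟨rfl, rfl⟩; rfl⟩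
  simpa [bnToNormalForm_pow_mul_pow] using congrArg (bnToNormalForm c) h

theorem bB_pow_mul_bA_pow {n m : ℕ} (hn : 1 ≤ n) (hm : 0 < m) (r : ℕ) :
    bB n ^ m * bA n ^ r = bB n ^ (m + (n - 1) * r) := by
  induction r with
  | zero => simp
  | succ r ih =>
    obtain ⟨l, hl⟩ : ∃ l, m + (n - 1) * r = l + 1 := ⟨m + (n - 1) * r - 1, by omega⟩
    rw [pow_succ, ← mul_assoc, ih, hl, pow_succ, mul_assoc, bB_mul_bA, ← pow_add, mul_add, mul_one,
      ← add_assoc, hl]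
    congr 1
    omega

theorem bA_pow_mul_bB_pow_mul_of_pos {n m : ℕ} (hn : 1 ≤ n) (hm : 0 < m) (k r s : ℕ) :
    (bA n ^ k * bB n ^ m) * (bA n ^ r * bB n ^ s) =
      bA n ^ k * bB n ^ (m + (n - 1) * r + s) := by
  rw [mul_assoc, ← mul_assoc (bB n ^ m), bB_pow_mul_bA_pow hn hm, ← pow_add]

theorem bA_pow_mul_bB_pow_zero_mul (n k r s : ℕ) :
    (bA n ^ k * bB n ^ 0) * (bA n ^ r * bB n ^ s) = bA n ^ (k + r) * bB n ^ s := by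
  rw [pow_zero, mul_one, ← mul_assoc, ← pow_add]

theorem exists_eq_bA_pow_mul_bB_pow {n : ℕ} (hn : 1 ≤ n) (x : Bn n) :
    ∃ k m : ℕ, x = bA n ^ k * bB n ^ m := by
  induction x using Con.induction_on with
  | _ w =>
    induction w using FreeMonoid.inductionOn' with
    | one => exact ⟨0, 0, by simp⟩
    | of_mul i w ih =>
      obtain ⟨r, s, h⟩ := ih
      rw [Con.coe_mul, h]
      fin_cases i
      · exact ⟨1 + r, s, by simpa [bA] using bA_pow_mul_bB_pow_zero_mul n 1 r s⟩
      · exact ⟨0, 1 + (n - 1) * r + s,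
          by simpa [bB] using bA_pow_mul_bB_pow_mul_of_pos hn one_pos 0 r s⟩

theorem bA_pow_mul_bB_pow_eq_one_iff {n : ℕ} (hn : 1 ≤ n) {k m : ℕ} :
    bA n ^ k * bB n ^ m = 1 ↔ k = 0 ∧ m = 0 := by
  simpa using bA_pow_mul_bB_pow_inj hn (k := k) (m := m) (r := 0) (s := 0)

theorem bn_mul_right_cancel {n : ℕ} (hn : 1 ≤ n) {x y z : Bn n} (h : x * z = y * z) : x = y := by
  obtain ⟨k, m, rfl⟩ := exists_eq_bA_pow_mul_bB_pow hn x
  obtain ⟨k', m', rfl⟩ := exists_eq_bA_pow_mul_bB_pow hn y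
  obtain ⟨r, s, rfl⟩ := exists_eq_bA_pow_mul_bB_pow hn z
  rw [bA_pow_mul_bB_pow_inj hn]
  rcases Nat.eq_zero_or_pos m with rfl | hm <;> rcases Nat.eq_zero_or_pos m' with rfl | hm'
  all_goals
    simp only [bA_pow_mul_bB_pow_zero_mul, bA_pow_mul_bB_pow_mul_of_pos hn, *,
      bA_pow_mul_bB_pow_inj hn] at h
    omega

theorem bn_eq_one_of_mul_eq_left {n : ℕ} (hn : 2 ≤ n) {x u : Bn n} (h : x * u = x) : u = 1 := by
  have hn' : 1 ≤ n := by omega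
  obtain ⟨k, m, rfl⟩ := exists_eq_bA_pow_mul_bB_pow hn' x
  obtain ⟨r, s, rfl⟩ := exists_eq_bA_pow_mul_bB_pow hn' u
  rw [bA_pow_mul_bB_pow_eq_one_iff hn']
  rcases Nat.eq_zero_or_pos m with rfl | hm
  · rw [bA_pow_mul_bB_pow_zero_mul, bA_pow_mul_bB_pow_inj hn'] at h
    omega
  · rw [bA_pow_mul_bB_pow_mul_of_pos hn' hm, bA_pow_mul_bB_pow_inj hn'] at h
    have hr : (n - 1) * r = 0 := by omega
    rcases Nat.mul_eq_zero.mp hr with h0 | h0 <;> omega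

theorem bn_eq_one_of_mul_eq_one {n : ℕ} (hn : 1 ≤ n) {x y : Bn n} (h : x * y = 1) : x = 1 := by
  obtain ⟨k, m, rfl⟩ := exists_eq_bA_pow_mul_bB_pow hn x
  obtain ⟨r, s, rfl⟩ := exists_eq_bA_pow_mul_bB_pow hn y
  rw [bA_pow_mul_bB_pow_eq_one_iff hn]
  rcases Nat.eq_zero_or_pos m with rfl | hm
  · rw [bA_pow_mul_bB_pow_zero_mul, bA_pow_mul_bB_pow_eq_one_iff hn] at h
    omega
  · rw [bA_pow_mul_bB_pow_mul_of_pos hn hm, bA_pow_mul_bB_pow_eq_one_iff hn] at h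
    omega

theorem bn_isUnit_iff {n : ℕ} (hn : 1 ≤ n) {x : Bn n} : IsUnit x ↔ x = 1 := by
  refine ⟨fun h => ?_, by rintro rfl; exact isUnit_one⟩
  obtain ⟨y, hy⟩ := h.exists_right_inv
  exact bn_eq_one_of_mul_eq_one hn hy

theorem bA_ne_one {n : ℕ} (hn : 1 ≤ n) : bA n ≠ 1 := fun h => by
  have := bA_pow_mul_bB_pow_eq_one_iff hn (k := 1) (m := 0)
  simp [h] at this

theorem bB_ne_one {n : ℕ} (hn : 1 ≤ n) : bB n ≠ 1 := fun h => by
  have := bA_pow_mul_bB_pow_eq_one_iff hn (k := 0) (m := 1)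
  simp [h] at this

theorem isMonAtom_bA {n : ℕ} (hn : 1 ≤ n) : IsMonAtom (bA n) := by
  refine ⟨fun h => bA_ne_one hn ((bn_isUnit_iff hn).mp h), fun x y h => ?_⟩
  obtain ⟨k, m, rfl⟩ := exists_eq_bA_pow_mul_bB_pow hn x
  obtain ⟨r, s, rfl⟩ := exists_eq_bA_pow_mul_bB_pow hn y
  simp only [bn_isUnit_iff hn, bA_pow_mul_bB_pow_eq_one_iff hn]
  replace h := (show bA n ^ 1 * bB n ^ 0 = bA n by simp).trans h
  rcases Nat.eq_zero_or_pos m with rfl | hm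
  · rw [bA_pow_mul_bB_pow_zero_mul, bA_pow_mul_bB_pow_inj hn] at h
    omega
  · rw [bA_pow_mul_bB_pow_mul_of_pos hn hm, bA_pow_mul_bB_pow_inj hn] at h
    omega

theorem isMonAtom_bB {n : ℕ} (hn : 2 ≤ n) : IsMonAtom (bB n) := by
  have hn' : 1 ≤ n := by omega
  refine ⟨fun h => bB_ne_one hn' ((bn_isUnit_iff hn').mp h), fun x y h => ?_⟩
  obtain ⟨k, m, rfl⟩ := exists_eq_bA_pow_mul_bB_pow hn' x
  obtain ⟨r, s, rfl⟩ := exists_eq_bA_pow_mul_bB_pow hn' y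
  simp only [bn_isUnit_iff hn', bA_pow_mul_bB_pow_eq_one_iff hn']
  replace h := (show bA n ^ 0 * bB n ^ 1 = bB n by simp).trans h
  rcases Nat.eq_zero_or_pos m with rfl | hm
  · rw [bA_pow_mul_bB_pow_zero_mul, bA_pow_mul_bB_pow_inj hn'] at h
    omega
  · rw [bA_pow_mul_bB_pow_mul_of_pos hn' hm, bA_pow_mul_bB_pow_inj hn'] at h
    have hr : (n - 1) * r = 0 := by omega
    rcases Nat.mul_eq_zero.mp hr with h0 | h0 <;> omega

theorem bn_monAtomic {n : ℕ} (hn : 2 ≤ n) : MonAtomic (Bn n) := by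
  intro x _
  obtain ⟨k, m, rfl⟩ := exists_eq_bA_pow_mul_bB_pow (by omega) x
  refine ⟨List.replicate k (bA n) ++ List.replicate m (bB n), fun u hu => ?_, by simp⟩
  rcases List.mem_append.mp hu with h | h <;> rw [List.eq_of_mem_replicate h]
  · exact isMonAtom_bA (by omega)
  · exact isMonAtom_bB hn

theorem bn_eq_of_isMonAtom {n : ℕ} (hn : 1 ≤ n) {u : Bn n} (hu : IsMonAtom u) :
    u = bA n ∨ u = bB n := by
  obtain ⟨h1, h2⟩ := hu
  simp only [bn_isUnit_iff hn] at h1 h2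
  obtain ⟨k, m, rfl⟩ := exists_eq_bA_pow_mul_bB_pow hn u
  rcases k with _ | k
  · rcases m with _ | m
    · simp at h1
    · have h := (h2 (bB n) (bB n ^ m) (by simp [pow_succ'])).resolve_left (bB_ne_one hn)
      exact .inr (by simp [pow_succ', h])
  · have h := (h2 (bA n) (bA n ^ k * bB n ^ m)
      (by rw [pow_succ', mul_assoc])).resolve_left (bA_ne_one hn)
    exact .inl (by rw [pow_succ', mul_assoc, h, mul_one])

/-- For `n ≥ 2`, in the monoid `B_n = ⟨a, b ∣ ba = b^n⟩`: every
element has the form `a^k * b^m`; multiplication is given by the stated formulas;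
`B_n` is reduced, unit-cancellative, right-cancellative but not left-cancellative,
and atomic with set of atoms `{a, b}`. -/
theorem statement0 (n : ℕ) (hn : 2 ≤ n) :
    (∀ x : Bn n, ∃ k m : ℕ, x = bA n ^ k * bB n ^ m) ∧
    (∀ k r s : ℕ,
      (bA n ^ k * bB n ^ 0) * (bA n ^ r * bB n ^ s) = bA n ^ (k + r) * bB n ^ s) ∧
    (∀ k m r s : ℕ, 0 < m →
      (bA n ^ k * bB n ^ m) * (bA n ^ r * bB n ^ s)
        = bA n ^ k * bB n ^ (m + (n - 1) * r + s)) ∧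
    MonReduced (Bn n) ∧
    UnitCancellative (Bn n) ∧
    (∀ x y z : Bn n, x * z = y * z → x = y) ∧
    ¬ (∀ x y z : Bn n, z * x = z * y → x = y) ∧
    MonAtomic (Bn n) ∧
    {u : Bn n | IsMonAtom u} = {bA n, bB n} := by
  have hn' : 1 ≤ n := by omega
  refine ⟨exists_eq_bA_pow_mul_bB_pow hn', bA_pow_mul_bB_pow_zero_mul n,
    fun k m r s hm => bA_pow_mul_bB_pow_mul_of_pos hn' hm k r s,
    fun u hu => (bn_isUnit_iff hn').mp hu,
    ⟨fun x u h => (bn_isUnit_iff hn').mpr (bn_eq_one_of_mul_eq_left hn h),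
      fun x u h => (bn_isUnit_iff hn').mpr
        (bn_mul_right_cancel hn' (h.trans (one_mul x).symm))⟩,
    fun x y z h => bn_mul_right_cancel hn' h, fun H => ?_, bn_monAtomic hn,
    Set.ext fun u => ⟨bn_eq_of_isMonAtom hn', ?_⟩⟩
  · have h : bA n = bB n ^ (n - 1) :=
      H _ _ (bB n) (by rw [bB_mul_bA, ← pow_succ', Nat.sub_add_cancel hn'])
    have h' := bA_pow_mul_bB_pow_inj hn' (k := 1) (m := 0) (r := 0) (s := n - 1)
    simp [h] at h'
  · rintro (rfl | rfl)
    · exact isMonAtom_bA hn'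
    · exact isMonAtom_bB hn
end

section
/- Let n ∈ ℕ with n ≥ 2 and let k, m ∈ ℕ₀. In the monoid B_n = ⟨a, b | ba = b^n⟩, the set of lengths of the element a^k b^m is L(a^k b^m) = k + m − q_{m,n}(n−2) + (n−2)·[0, q_{m,n}], i.e. the arithmetical progression {k + m − q_{m,n}(n−2) + (n−2)j : j ∈ [0, q_{m,n}]}. -/
attribute [local instance] Classical.propDecidable

/-- The quantity `q_{m,n}`. -/
def qOf (m n : ℕ) : ℕ :=
  if m = 0 then 0 else if (n - 1) ∣ m then m / (n - 1) - 1 else m / (n - 1)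

/-- The arithmetical progression `x + d·[0,q] = {x + d*j : 0 ≤ j ≤ q}`. -/
def apSet (x d q : ℕ) : Set ℕ := {y | ∃ j : ℕ, j ≤ q ∧ y = x + d * j}

/-- The homomorphism out of `B_n` determined by a pair `x, y` with `y * x = y ^ n`. -/
def BnLift {M : Type*} [Monoid M] (n : ℕ) (x y : M) (h : y * x = y ^ n) : Bn n →* M :=
  (BnCon n).lift (FreeMonoid.lift ![x, y]) <| by
    rw [BnCon, Con.conGen_le]
    rintro _ _ ⟨rfl, rfl⟩
    simp [Con.ker_rel, h]

section

variable {M : Type*} [Monoid M] (n : ℕ) (x y : M) (h : y * x = y ^ n)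

@[simp]
theorem BnLift_bA : BnLift n x y h (bA n) = x :=
  rfl

@[simp]
theorem BnLift_bB : BnLift n x y h (bB n) = y :=
  rfl

end

/-- Left multiplication by `a` on the exponents of the normal forms `a ^ k * b ^ m`. -/
def actA : Function.End (ℕ × ℕ) := fun p => (p.1 + 1, p.2)

/-- Left multiplication by `b` on the exponents of the normal forms `a ^ k * b ^ m`. -/
def actB (n : ℕ) : Function.End (ℕ × ℕ) := fun p => (0, p.2 + (n - 1) * p.1 + 1)

theorem actB_pow_apply (n t m : ℕ) : (actB n ^ t) (0, m) = (0, m + t) := by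
  induction t with
  | zero => rfl
  | succ t ih =>
    rw [pow_succ']
    change actB n ((actB n ^ t) (0, m)) = _
    rw [ih]
    simp [actB, add_assoc]

theorem actA_pow_apply (t k m : ℕ) : (actA ^ t) (k, m) = (k + t, m) := by
  induction t with
  | zero => rfl
  | succ t ih =>
    rw [pow_succ']
    change actA ((actA ^ t) (k, m)) = _
    rw [ih]
    simp [actA, add_assoc]

theorem actB_mul_actA (n : ℕ) (hn : 1 ≤ n) : actB n * actA = actB n ^ n := by
  obtain ⟨d, rfl⟩ := Nat.exists_eq_add_of_le' hn
  funext p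
  rw [pow_succ]
  change actB (d + 1) (actA p) = (actB (d + 1) ^ d) (actB (d + 1) p)
  have : actB (d + 1) p = (0, p.2 + d * p.1 + 1) := rfl
  rw [this, actB_pow_apply]
  simp only [actB, actA, Nat.add_sub_cancel, Prod.mk.injEq, true_and]
  ring

/-- The exponents `(k, m)` of the normal form `a ^ k * b ^ m` of an element of `B_n`. -/
def normalForm (n : ℕ) (hn : 1 ≤ n) (x : Bn n) : ℕ × ℕ :=
  BnLift n actA (actB n) (actB_mul_actA n hn) x (0, 0)

theorem normalForm_bA_mul (n : ℕ) (hn : 1 ≤ n) (x : Bn n) :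
    normalForm n hn (bA n * x) = ((normalForm n hn x).1 + 1, (normalForm n hn x).2) := by
  simp only [normalForm, map_mul, BnLift_bA]
  rfl

theorem normalForm_bB_mul (n : ℕ) (hn : 1 ≤ n) (x : Bn n) :
    normalForm n hn (bB n * x) =
      (0, (normalForm n hn x).2 + (n - 1) * (normalForm n hn x).1 + 1) := by
  simp only [normalForm, map_mul, BnLift_bB]
  rfl

theorem normalForm_pow_mul_pow (n : ℕ) (hn : 1 ≤ n) (k m : ℕ) :
    normalForm n hn (bA n ^ k * bB n ^ m) = (k, m) := by
  simp only [normalForm, map_mul, map_pow, BnLift_bA, BnLift_bB]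
  change (actA ^ k) ((actB n ^ m) (0, 0)) = _
  rw [actB_pow_apply, actA_pow_apply]
  simp

theorem exists_list_prod_eq (n : ℕ) (x : Bn n) :
    ∃ l : List (Bn n), (∀ u ∈ l, u = bA n ∨ u = bB n) ∧ l.prod = x := by
  induction x using Con.induction_on with
  | H w =>
    induction w using FreeMonoid.inductionOn' with
    | one => exact ⟨[], by simp, rfl⟩
    | of_mul g w ih =>
      obtain ⟨l, hl, hw⟩ := ih
      refine ⟨(BnCon n).mk' (FreeMonoid.of g) :: l, ?_, ?_⟩
      · rintro u hu
        rcases List.mem_cons.1 hu with rfl | hu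
        · fin_cases g
          · exact Or.inl rfl
          · exact Or.inr rfl
        · exact hl u hu
      · rw [List.prod_cons, hw]
        rfl

theorem length_of_normalForm_prod (n : ℕ) (hn : 2 ≤ n) (l : List (Bn n))
    (hl : ∀ u ∈ l, u = bA n ∨ u = bB n) :
    ∃ i, (i = 0 ∨ (n - 1) * i < (normalForm n (by lia) l.prod).2) ∧
      l.length + (n - 2) * i =
        (normalForm n (by lia) l.prod).1 + (normalForm n (by lia) l.prod).2 := by
  obtain ⟨d, rfl⟩ := Nat.exists_eq_add_of_le' hn
  induction l with
  | nil => exact ⟨0, Or.inl rfl, rfl⟩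
  | cons u l ih =>
    obtain ⟨i, hi, hlen⟩ := ih fun v hv => hl v (List.mem_cons_of_mem _ hv)
    rw [List.prod_cons, List.length_cons]
    rcases hl u List.mem_cons_self with rfl | rfl
    · rw [normalForm_bA_mul]
      exact ⟨i, hi, by simp only; lia⟩
    · rw [normalForm_bB_mul]
      generalize normalForm (d + 2) _ l.prod = p at hi hlen ⊢
      have e1 : d + 2 - 1 = d + 1 := rfl
      simp only [e1, Nat.add_sub_cancel] at hi hlen ⊢
      refine ⟨i + p.1, Or.inr ?_, by linear_combination hlen⟩
      rcases hi with rfl | hi <;> nlinarith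

theorem length_eq_of_prod_eq_pow (n : ℕ) (hn : 2 ≤ n) (k m : ℕ) (l : List (Bn n))
    (hl : ∀ u ∈ l, u = bA n ∨ u = bB n) (h : l.prod = bA n ^ k * bB n ^ m) :
    ∃ i, (i = 0 ∨ (n - 1) * i < m) ∧ l.length + (n - 2) * i = k + m := by
  have := length_of_normalForm_prod n hn l hl
  rwa [h, normalForm_pow_mul_pow] at this

theorem bB_mul_bA_pow (n i : ℕ) (hn : 1 ≤ n) :
    bB n * bA n ^ i = bB n ^ (1 + (n - 1) * i) := by
  induction i with
  | zero => simp
  | succ i ih =>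
    rw [pow_succ, ← mul_assoc, ih, add_comm, pow_succ, mul_assoc, bB_mul_bA, ← pow_add]
    congr 1
    rw [mul_add]
    lia

theorem exists_list_of_length (n : ℕ) (hn : 2 ≤ n) (k m i : ℕ)
    (hi : i = 0 ∨ (n - 1) * i < m) :
    ∃ l : List (Bn n), (∀ u ∈ l, u = bA n ∨ u = bB n) ∧
      l.length + (n - 2) * i = k + m ∧ l.prod = bA n ^ k * bB n ^ m := by
  rcases hi with rfl | hi
  · refine ⟨List.replicate k (bA n) ++ List.replicate m (bB n), ?_, by simp, by simp⟩
    simp only [List.mem_append, List.mem_replicate]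
    tauto
  · obtain ⟨r, rfl⟩ := Nat.exists_eq_add_of_lt hi
    refine ⟨List.replicate k (bA n) ++ (bB n :: (List.replicate i (bA n) ++
      List.replicate r (bB n))), ?_, ?_, ?_⟩
    · simp only [List.mem_append, List.mem_cons, List.mem_replicate]
      tauto
    · obtain ⟨d, rfl⟩ := Nat.exists_eq_add_of_le' hn
      have e1 : d + 2 - 1 = d + 1 := rfl
      simp only [e1, Nat.add_sub_cancel, List.length_append, List.length_cons,
        List.length_replicate]
      ring
    · simp only [List.prod_append, List.prod_cons, List.prod_replicate]
      rw [← mul_assoc (bB n), bB_mul_bA_pow n i (by lia), ← pow_add]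
      congr 2
      lia

/-- The weight homomorphism sending `a` to `n - 1` and `b` to `1`. -/
def BnWeight (n : ℕ) (hn : 1 ≤ n) : Bn n →* Multiplicative ℕ :=
  BnLift n (Multiplicative.ofAdd (n - 1)) (Multiplicative.ofAdd 1) <| by
    rw [← ofAdd_add, ← ofAdd_nsmul]
    congr 1
    simp only [smul_eq_mul]
    lia

theorem not_isUnit_of_eq (n : ℕ) (hn : 2 ≤ n) (g x : Bn n) (hg : g = bA n ∨ g = bB n) :
    ¬ IsUnit (g * x) := by
  intro h
  have h1 := h.map (BnWeight n (by lia))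
  have h2 : Multiplicative.toAdd (BnWeight n (by lia) (g * x)) = 0 :=
    congrArg Multiplicative.toAdd (isUnit_iff_eq_one.1 h1)
  rw [map_mul, toAdd_mul] at h2
  rcases hg with rfl | rfl
  · rw [BnWeight, BnLift_bA, toAdd_ofAdd] at h2
    lia
  · rw [BnWeight, BnLift_bB, toAdd_ofAdd] at h2
    lia

theorem monReduced_Bn (n : ℕ) (hn : 2 ≤ n) : MonReduced (Bn n) := by
  intro x hx
  obtain ⟨l, hl, rfl⟩ := exists_list_prod_eq n x
  cases l with
  | nil => rfl
  | cons g l =>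
    rw [List.prod_cons] at hx
    exact absurd hx (not_isUnit_of_eq n hn g _ (hl g List.mem_cons_self))

theorem isMonAtom_iff (n : ℕ) (hn : 2 ≤ n) (u : Bn n) :
    IsMonAtom u ↔ u = bA n ∨ u = bB n := by
  constructor
  · rintro ⟨hu, h⟩
    obtain ⟨l, hl, rfl⟩ := exists_list_prod_eq n u
    cases l with
    | nil => exact absurd isUnit_one hu
    | cons g l =>
      have hg := hl g List.mem_cons_self
      rcases h _ _ List.prod_cons with h | h
      · exact absurd h (by simpa using not_isUnit_of_eq n hn g 1 hg)
      · rwa [List.prod_cons, monReduced_Bn n hn _ h, mul_one]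
  · intro hu
    refine ⟨by simpa using not_isUnit_of_eq n hn u 1 hu, ?_⟩
    rintro x y h
    obtain ⟨l, hl, rfl⟩ := exists_list_prod_eq n x
    obtain ⟨l', hl', rfl⟩ := exists_list_prod_eq n y
    have hmem : ∀ v ∈ l ++ l', v = bA n ∨ v = bB n := fun v hv =>
      (List.mem_append.1 hv).elim (hl v) (hl' v)
    have hlen : (l ++ l').length ≤ 1 := by
      rw [← List.prod_append] at h
      rcases hu with rfl | rfl
      · obtain ⟨i, -, hi⟩ := length_eq_of_prod_eq_pow n hn 1 0 _ hmem (by simp [← h])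
        lia
      · obtain ⟨i, -, hi⟩ := length_eq_of_prod_eq_pow n hn 0 1 _ hmem (by simp [← h])
        lia
    rw [List.length_append] at hlen
    rcases l with _ | ⟨g, l⟩
    · exact Or.inl isUnit_one
    · rcases l' with _ | ⟨g', l'⟩
      · exact Or.inr isUnit_one
      · simp only [List.length_cons] at hlen
        lia

theorem qOf_eq (m n : ℕ) (hn : 2 ≤ n) : qOf m n = (m - 1) / (n - 1) := by
  rcases m with _ | m
  · simp [qOf]
  · obtain ⟨d, rfl⟩ := Nat.exists_eq_add_of_le' hn
    have e1 : d + 2 - 1 = d + 1 := rfl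
    rw [qOf, e1, Nat.succ_div]
    split_ifs <;> simp_all

theorem le_qOf_iff (m n i : ℕ) (hn : 2 ≤ n) : i ≤ qOf m n ↔ i = 0 ∨ (n - 1) * i < m := by
  rw [qOf_eq m n hn, Nat.le_div_iff_mul_le (by lia), mul_comm]
  rcases i with _ | i
  · simp
  · have : 0 < (n - 1) * (i + 1) := Nat.mul_pos (by lia) (by lia)
    lia

theorem mem_apSet_iff (n : ℕ) (hn : 2 ≤ n) (k m t : ℕ) :
    t ∈ apSet (k + m - qOf m n * (n - 2)) (n - 2) (qOf m n) ↔
      ∃ i, (i = 0 ∨ (n - 1) * i < m) ∧ t + (n - 2) * i = k + m := by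
  have hq : qOf m n * (n - 2) ≤ k + m := by
    rcases (le_qOf_iff m n _ hn).1 le_rfl with h | h
    · simp [h]
    · calc qOf m n * (n - 2) ≤ qOf m n * (n - 1) := Nat.mul_le_mul_left _ (by lia)
        _ ≤ k + m := by rw [mul_comm]; lia
  simp only [apSet, Set.mem_ofPred_eq, ← le_qOf_iff m n _ hn]
  generalize qOf m n = q at hq ⊢
  have key : ∀ i j, i + j = q → (n - 2) * i + (n - 2) * j = q * (n - 2) := by
    rintro i j rfl
    ring
  constructor
  · rintro ⟨j, hj, rfl⟩
    have := key (q - j) j (by lia)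
    exact ⟨q - j, by lia, by lia⟩
  · rintro ⟨i, hi, h⟩
    have := key i (q - i) (by lia)
    exact ⟨q - i, by lia, by lia⟩

/-- For `n ≥ 2` and `k, m ∈ ℕ₀`, the set of lengths of
`a^k * b^m` in `B_n` is the arithmetical progression
`(k + m − q_{m,n}(n−2)) + (n−2)·[0, q_{m,n}]`. -/
theorem statement3 (n : ℕ) (hn : 2 ≤ n) (k m : ℕ) :
    setOfLengths (bA n ^ k * bB n ^ m)
      = apSet (k + m - qOf m n * (n - 2)) (n - 2) (qOf m n) := by
  ext t
  rw [mem_apSet_iff n hn, setOfLengths]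
  split_ifs with h1
  · have h := normalForm_pow_mul_pow n (by lia) k m
    rw [h1] at h
    have h0 : (0, 0) = (k, m) := h
    obtain ⟨rfl, rfl⟩ := Prod.mk.inj h0
    simp
  · simp only [Set.mem_ofPred_eq, isMonAtom_iff n hn]
    constructor
    · rintro ⟨l, rfl, hl, h⟩
      exact length_eq_of_prod_eq_pow n hn k m l hl h
    · rintro ⟨i, hi, h⟩
      obtain ⟨l, hl, hlen, hprod⟩ := exists_list_of_length n hn k m i hi
      exact ⟨l, by lia, hl, hprod⟩
end

section
/- Let n ∈ ℕ with n ≥ 3. Then the elasticity of B_n = ⟨a, b | ba = b^n⟩ satisfies ρ(B_n) = n − 1, and ρ(L) < n − 1 for every L ∈ 𝓛(B_n); in particular, B_n does not have accepted elasticity. -/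
attribute [local instance] Classical.propDecidable

open scoped ENNReal

/-- The elasticity `ρ(L)` of a set `L ⊆ ℕ₀`:
`ρ(L) = sup(L∩ℕ)/min(L∩ℕ)` if `L ∩ ℕ ≠ ∅` and `ρ(L) = 1` otherwise. -/
noncomputable def setElasticity (L : Set ℕ) : ℝ≥0∞ :=
  if (L \ {0}).Nonempty then
    sSup ((fun k : ℕ => (k : ℝ≥0∞)) '' (L \ {0})) / ((sInf (L \ {0}) : ℕ) : ℝ≥0∞)
  else 1

/-- The elasticity `ρ(M) = sup {ρ(L) : L ∈ 𝓛(M)}` of a monoid. -/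
noncomputable def monElasticity (M : Type*) [Monoid M] : ℝ≥0∞ :=
  sSup (setElasticity '' LSystem M)

/-- A monoid has accepted elasticity if some `L ∈ 𝓛(M)` satisfies
`ρ(L) = ρ(M) < ∞`. -/
def AcceptedElasticity (M : Type*) [Monoid M] : Prop :=
  ∃ L ∈ LSystem M, setElasticity L = monElasticity M ∧ monElasticity M < ⊤

namespace Bn

/-- The universal property of `B_n`. -/
def lift {n : ℕ} {P : Type*} [Monoid P] (x y : P) (h : y * x = y ^ n) : Bn n →* P :=
  (BnCon n).lift (FreeMonoid.lift ![x, y]) <| Con.conGen_le.2 <| by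
    rintro _ _ ⟨rfl, rfl⟩
    simpa [Con.ker_rel] using h

@[simp]
theorem lift_bA {n : ℕ} {P : Type*} [Monoid P] (x y : P) (h : y * x = y ^ n) :
    lift x y h (bA n) = x :=
  (Con.lift_mk' _ _).trans (by simp)

@[simp]
theorem lift_bB {n : ℕ} {P : Type*} [Monoid P] (x y : P) (h : y * x = y ^ n) :
    lift x y h (bB n) = y :=
  (Con.lift_mk' _ _).trans (by simp)

theorem bB_mul_bA (n : ℕ) : bB n * bA n = bB n ^ n := by
  have h : BnCon n (FreeMonoid.of 1 * FreeMonoid.of 0) (FreeMonoid.of 1 ^ n) :=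
    ConGen.Rel.of _ _ ⟨rfl, rfl⟩
  exact (Con.eq (BnCon n)).2 h

theorem bB_mul_bA_pow (m k : ℕ) :
    bB (m + 1) * bA (m + 1) ^ k = bB (m + 1) ^ (m * k + 1) := by
  induction k with
  | zero => simp
  | succ k ih =>
    rw [pow_succ, ← mul_assoc, ih, pow_succ, mul_assoc, bB_mul_bA, ← pow_add]
    congr 1

theorem eq_one_or_exists_mul {n : ℕ} (u : Bn n) :
    u = 1 ∨ (∃ v, u = bA n * v) ∨ ∃ v, u = bB n * v := by
  induction u using Con.induction_on with
  | H w =>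
    cases w using FreeMonoid.casesOn with
    | one => exact Or.inl rfl
    | of_mul i w =>
      fin_cases i
      · exact Or.inr (Or.inl ⟨w, rfl⟩)
      · exact Or.inr (Or.inr ⟨w, rfl⟩)

/-- The degree on `B_{m+1}` in which `a` has degree `m` and `b` has degree `1`. -/
def degHom (m : ℕ) : Bn (m + 1) →* Multiplicative ℕ :=
  lift (Multiplicative.ofAdd m) (Multiplicative.ofAdd 1) <| by
    rw [← ofAdd_add, ← ofAdd_nsmul, smul_eq_mul, mul_one, add_comm]

/-- The value of `degHom` as a natural number. -/
def deg {m : ℕ} (u : Bn (m + 1)) : ℕ := (degHom m u).toAdd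

section deg

variable {m : ℕ}

@[simp]
theorem deg_one : deg (1 : Bn (m + 1)) = 0 := by simp [deg]

@[simp]
theorem deg_mul (u v : Bn (m + 1)) : deg (u * v) = deg u + deg v := by simp [deg]

@[simp]
theorem deg_bA : deg (bA (m + 1)) = m := by simp [deg, degHom]

@[simp]
theorem deg_bB : deg (bB (m + 1)) = 1 := by simp [deg, degHom]

theorem deg_eq_zero (hm : 1 ≤ m) {u : Bn (m + 1)} (h : deg u = 0) : u = 1 := by
  obtain h1 | ⟨v, rfl⟩ | ⟨v, rfl⟩ := eq_one_or_exists_mul u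
  · exact h1
  · simp at h; omega
  · simp at h

theorem isUnit_iff_deg (hm : 1 ≤ m) {u : Bn (m + 1)} : IsUnit u ↔ deg u = 0 := by
  refine ⟨fun ⟨⟨x, y, hxy, _⟩, hu⟩ => ?_, fun h => deg_eq_zero hm h ▸ isUnit_one⟩
  have := congrArg deg hxy
  simp only [deg_mul, deg_one, Nat.add_eq_zero_iff] at this
  exact hu ▸ this.1

/-- The homomorphism to `(ℕ, *)` sending `a` to `1` and `b` to `0`: it vanishes exactly on the
elements all of whose representing words contain the letter `b`. -/
def avoidB (m : ℕ) : Bn (m + 1) →* ℕ := lift 1 0 (by simp)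

@[simp]
theorem avoidB_bA : avoidB m (bA (m + 1)) = 1 := by simp [avoidB]

@[simp]
theorem avoidB_bB : avoidB m (bB (m + 1)) = 0 := by simp [avoidB]

theorem isMonAtom_bA (hm : 1 ≤ m) : IsMonAtom (bA (m + 1)) := by
  refine ⟨by rw [isUnit_iff_deg hm, deg_bA]; omega, fun c d h => ?_⟩
  obtain rfl | ⟨v, rfl⟩ | ⟨v, rfl⟩ := eq_one_or_exists_mul c
  · exact Or.inl isUnit_one
  · right
    have := congrArg deg h
    simp only [deg_mul, deg_bA] at this
    rw [isUnit_iff_deg hm]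
    omega
  · simpa using congrArg (avoidB m) h

theorem isMonAtom_bB (hm : 1 ≤ m) : IsMonAtom (bB (m + 1)) := by
  refine ⟨by simp [isUnit_iff_deg hm], fun c d h => ?_⟩
  have := congrArg deg h
  simp only [deg_mul, deg_bB] at this
  simp only [isUnit_iff_deg hm]
  omega

theorem eq_bA_or_eq_bB (hm : 1 ≤ m) {u : Bn (m + 1)} (hu : IsMonAtom u) :
    u = bA (m + 1) ∨ u = bB (m + 1) := by
  obtain rfl | ⟨v, rfl⟩ | ⟨v, rfl⟩ := eq_one_or_exists_mul u
  · exact absurd isUnit_one hu.1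
  · obtain h | h := hu.2 _ _ rfl
    · exact absurd h (isMonAtom_bA hm).1
    · rw [deg_eq_zero hm ((isUnit_iff_deg hm).1 h), mul_one]
      exact Or.inl rfl
  · obtain h | h := hu.2 _ _ rfl
    · exact absurd h (isMonAtom_bB hm).1
    · rw [deg_eq_zero hm ((isUnit_iff_deg hm).1 h), mul_one]
      exact Or.inr rfl

theorem length_bounds (hm : 2 ≤ m) (l : List (Bn (m + 1))) (hl : ∀ u ∈ l, IsMonAtom u) :
    l.length ≤ deg l.prod ∧
      (avoidB m l.prod = 1 ∧ deg l.prod = m * l.length ∨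
        avoidB m l.prod = 0 ∧ deg l.prod < m * l.length) := by
  induction l with
  | nil => simp
  | cons u l ih =>
    have ih := ih fun v hv => hl v (List.mem_cons_of_mem _ hv)
    have hmul : m * (l.length + 1) = m * l.length + m := by ring
    obtain rfl | rfl := eq_bA_or_eq_bB (by omega) (hl u List.mem_cons_self)
    · simp only [List.prod_cons, List.length_cons, map_mul, deg_mul, deg_bA, avoidB_bA, one_mul,
        hmul]
      omega
    · simp only [List.prod_cons, List.length_cons, map_mul, deg_mul, deg_bB, avoidB_bB, zero_mul,
        true_and, hmul]
      omega

theorem lt_mul_of_mem_setOfLengths (hm : 2 ≤ m) {x : Bn (m + 1)} (hx : x ≠ 1) {j k : ℕ}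
    (hj : j ∈ setOfLengths x) (hk : k ∈ setOfLengths x) : j < m * k := by
  rw [setOfLengths, if_neg hx] at hj hk
  obtain ⟨l, rfl, hl, hlx⟩ := hj
  obtain ⟨l', rfl, hl', hlx'⟩ := hk
  have h := length_bounds hm l hl
  have h' := length_bounds hm l' hl'
  rw [hlx] at h
  rw [hlx'] at h'
  obtain ⟨h1, ⟨hA, hd⟩ | ⟨hA, hd⟩⟩ := h
  · have hpos : 0 < l.length := by
      rw [List.length_pos_iff]
      rintro rfl
      exact hx hlx.symm
    have : l.length < m * l.length := by nlinarith
    omega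
  · omega

theorem setElasticity_lt (hm : 2 ≤ m) (x : Bn (m + 1)) :
    setElasticity (setOfLengths x) < m := by
  rw [setElasticity]
  split_ifs with hne
  · have hx : x ≠ 1 := by
      rintro rfl
      simp [setOfLengths] at hne
    set S := setOfLengths x \ {0}
    have hmin : sInf S ∈ S := Nat.sInf_mem hne
    have h0 : sInf S ≠ 0 := hmin.2
    have hpos : 0 < m * sInf S := Nat.mul_pos (by omega) (Nat.pos_of_ne_zero h0)
    rw [ENNReal.div_lt_iff (Or.inl (by exact_mod_cast h0)) (Or.inl (ENNReal.natCast_ne_top _))]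
    calc sSup ((fun k : ℕ => (k : ℝ≥0∞)) '' S) ≤ ((m * sInf S - 1 : ℕ) : ℝ≥0∞) := by
          refine sSup_le ?_
          rintro _ ⟨j, hj, rfl⟩
          have := lt_mul_of_mem_setOfLengths hm hx hj.1 hmin.1
          exact Nat.cast_le.2 (by omega)
      _ < ((m * sInf S : ℕ) : ℝ≥0∞) := Nat.cast_lt.2 (by omega)
      _ = m * (sInf S : ℕ) := by push_cast; rfl
  · exact_mod_cast (by omega : 1 < m)

theorem le_setElasticity_bB_mul_bA_pow (hm : 1 ≤ m) (k : ℕ) :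
    ((m * k + 1 : ℕ) : ℝ≥0∞) / ((k + 1 : ℕ) : ℝ≥0∞) ≤
      setElasticity (setOfLengths (bB (m + 1) * bA (m + 1) ^ k)) := by
  have hx : bB (m + 1) * bA (m + 1) ^ k ≠ 1 := fun h => by
    simpa using congrArg (avoidB m) h
  have hmin : k + 1 ∈ setOfLengths (bB (m + 1) * bA (m + 1) ^ k) \ {0} := by
    refine ⟨?_, by simp⟩
    rw [setOfLengths, if_neg hx]
    refine ⟨bB (m + 1) :: List.replicate k (bA (m + 1)), by simp, fun u hu => ?_, by simp⟩
    obtain rfl | hu := List.mem_cons.1 hu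
    · exact isMonAtom_bB hm
    · exact List.eq_of_mem_replicate hu ▸ isMonAtom_bA hm
  have hmax : m * k + 1 ∈ setOfLengths (bB (m + 1) * bA (m + 1) ^ k) \ {0} := by
    refine ⟨?_, by simp⟩
    rw [setOfLengths, if_neg hx]
    refine ⟨List.replicate (m * k + 1) (bB (m + 1)), by simp, fun u hu => ?_, ?_⟩
    · exact List.eq_of_mem_replicate hu ▸ isMonAtom_bB hm
    · rw [List.prod_replicate, bB_mul_bA_pow]
  rw [setElasticity, if_pos ⟨_, hmin⟩]
  exact ENNReal.div_le_div (le_sSup ⟨_, hmax, rfl⟩) (Nat.cast_le.2 (Nat.sInf_le hmin))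

end deg

end Bn

theorem ENNReal.natCast_le_of_forall_div_le {m : ℕ} {S : ℝ≥0∞}
    (h : ∀ k : ℕ, ((m * k + 1 : ℕ) : ℝ≥0∞) / ((k + 1 : ℕ) : ℝ≥0∞) ≤ S) : (m : ℝ≥0∞) ≤ S := by
  induction S with
  | top => exact le_top
  | coe s =>
    have h' (k : ℕ) : (m * k + 1 : ℝ) ≤ s * (k + 1) := by
      have := (ENNReal.div_le_iff (by simp) (ENNReal.natCast_ne_top _)).1 (h k)
      exact_mod_cast this
    by_contra! hlt
    have hs : (s : ℝ) < m := by exact_mod_cast hlt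
    obtain ⟨k, hk⟩ := exists_nat_gt ((s : ℝ) / (m - s))
    rw [div_lt_iff₀ (by linarith)] at hk
    linarith [h' k]

/-- For `n ≥ 3`, the elasticity of `B_n` is `ρ(B_n) = n − 1`,
while `ρ(L) < n − 1` for every `L ∈ 𝓛(B_n)`; in particular `B_n` does not have
accepted elasticity. -/
theorem statement5 (n : ℕ) (hn : 3 ≤ n) :
    monElasticity (Bn n) = (n : ℝ≥0∞) - 1 ∧
    (∀ L ∈ LSystem (Bn n), setElasticity L < (n : ℝ≥0∞) - 1) ∧
    ¬ AcceptedElasticity (Bn n) := by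
  obtain ⟨m, rfl⟩ : ∃ m, n = m + 1 := ⟨n - 1, by omega⟩
  have hm : 2 ≤ m := by omega
  have hcast : ((m + 1 : ℕ) : ℝ≥0∞) - 1 = m := by
    rw [Nat.cast_add, Nat.cast_one, ENNReal.add_sub_cancel_right ENNReal.one_ne_top]
  have hlt : ∀ L ∈ LSystem (Bn (m + 1)), setElasticity L < m := by
    rintro _ ⟨x, rfl⟩
    exact Bn.setElasticity_lt hm x
  have heq : monElasticity (Bn (m + 1)) = m := by
    apply le_antisymm
    · refine sSup_le ?_
      rintro _ ⟨L, hL, rfl⟩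
      exact (hlt L hL).le
    · exact ENNReal.natCast_le_of_forall_div_le fun k =>
        (Bn.le_setElasticity_bB_mul_bA_pow (by omega) k).trans
          (le_sSup ⟨_, ⟨_, rfl⟩, rfl⟩)
  rw [hcast]
  refine ⟨heq, hlt, ?_⟩
  rintro ⟨L, hL, hLeq, -⟩
  exact (hlt L hL).ne (hLeq.trans heq)
end

section
/- Let n ∈ ℕ with n ≥ 3. The monoid B_n = ⟨a, b | ba = b^n⟩ is not a transfer Krull monoid; that is, there exist no abelian group G, subset G_0 ⊆ G, and weak transfer homomorphism θ : B_n → B(G_0). -/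
attribute [local instance] Classical.propDecidable

/-- The monoid of zero-sum sequences `B(G₀)` over a subset `G₀` of an abelian
group `G`: the submonoid of the free abelian monoid on `G₀` (multisets over `G₀`)
consisting of those sequences whose sum is `0`. -/
def ZeroSums {G : Type*} [AddCommGroup G] (G₀ : Set G) :
    AddSubmonoid (Multiset G₀) where
  carrier := {s | (s.map Subtype.val).sum = 0}
  zero_mem' := by simp
  add_mem' := by
    intro s t hs ht
    simp only [Set.mem_setOf_eq, Multiset.map_add, Multiset.sum_add] at *
    rw [hs, ht, add_zero]

/-- A weak transfer homomorphism `θ : H → B` between atomic unit-cancellative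
monoids: **(T1)** `B = B^× θ(H) B^×` and `θ⁻¹(B^×) = H^×`; **(WT2)** whenever
`θ a = v_1 ⋯ v_k` with atoms `v_i` of `B`, there are atoms `u_1, …, u_k` of `H`
and a permutation `τ` with `a = u_1 ⋯ u_k` and `θ (u_i) ∈ B^× v_{τ i} B^×`. -/
def IsWeakTransferHom {H B : Type*} [Monoid H] [Monoid B] (θ : H →* B) : Prop :=
  (∀ b : B, ∃ (u v : B) (a : H), IsUnit u ∧ IsUnit v ∧ b = u * θ a * v) ∧
  (∀ a : H, IsUnit (θ a) ↔ IsUnit a) ∧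
  (∀ (a : H) (k : ℕ) (v : Fin k → B), 0 < k → (∀ i, IsMonAtom (v i)) →
    θ a = (List.ofFn v).prod →
    ∃ (u : Fin k → H) (τ : Equiv.Perm (Fin k)),
      a = (List.ofFn u).prod ∧ (∀ i, IsMonAtom (u i)) ∧
      ∀ i, ∃ e f : B, IsUnit e ∧ IsUnit f ∧ θ (u i) = e * v (τ i) * f)

/-- A zero-sum sequence of length zero is invertible. -/
theorem isUnit_of_card_eq_zero {G : Type*} [AddCommGroup G] {G₀ : Set G}
    {x : Multiplicative (ZeroSums G₀)} (hx : x.toAdd.1.card = 0) : IsUnit x := by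
  have h : x = 1 := by
    apply Multiplicative.toAdd.injective
    exact Subtype.ext (Multiset.card_eq_zero.mp hx)
  exact h ▸ isUnit_one

/-- The monoid of zero-sum sequences is atomic. -/
theorem monAtomic_zeroSums {G : Type*} [AddCommGroup G] (G₀ : Set G) :
    MonAtomic (Multiplicative (ZeroSums G₀)) := by
  intro x
  induction hk : x.toAdd.1.card using Nat.strong_induction_on generalizing x with
  | _ k ih =>
    intro hx
    by_cases hat : IsMonAtom x
    · exact ⟨[x], by simpa using hat, by simp⟩
    · have hfac : ∃ c d : Multiplicative (ZeroSums G₀), x = c * d ∧ ¬ IsUnit c ∧ ¬ IsUnit d := by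
        simp only [IsMonAtom] at hat
        push Not at hat
        exact hat hx
      obtain ⟨c, d, hcd, hc, hd⟩ := hfac
      have hsum : x.toAdd.1.card = c.toAdd.1.card + d.toAdd.1.card := by
        rw [hcd]
        exact Multiset.card_add _ _
      have hc0 := mt isUnit_of_card_eq_zero hc
      have hd0 := mt isUnit_of_card_eq_zero hd
      obtain ⟨l₁, hl₁, hp₁⟩ := ih c.toAdd.1.card (by omega) c rfl hc
      obtain ⟨l₂, hl₂, hp₂⟩ := ih d.toAdd.1.card (by omega) d rfl hd
      refine ⟨l₁ ++ l₂, fun u hu => ?_, by rw [List.prod_append, hp₁, hp₂, hcd]⟩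
      exact (List.mem_append.mp hu).elim (hl₁ u) (hl₂ u)

/-- The homomorphism from `B_n` to the multiplicative monoid of `ℤ/4ℤ` sending `a` to `2`
and `b` to `0`. -/
def bnToZMod (n : ℕ) (hn : n ≠ 0) : Bn n →* ZMod 4 :=
  (BnCon n).lift (FreeMonoid.lift ![2, 0]) (Con.conGen_le.mpr (by
    rintro x y ⟨rfl, rfl⟩
    simp [Con.ker_rel, hn]))

theorem bnToZMod_bA (n : ℕ) (hn : n ≠ 0) : bnToZMod n hn (bA n) = 2 := rfl

theorem bnToZMod_bB (n : ℕ) (hn : n ≠ 0) : bnToZMod n hn (bB n) = 0 := rfl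

theorem two_dvd_bnToZMod (n : ℕ) (hn : n ≠ 0) (x : Bn n) (hx : ¬ IsUnit x) :
    2 ∣ bnToZMod n hn x := by
  induction x using Con.induction_on with
  | H w =>
    induction w using FreeMonoid.casesOn with
    | one => exact absurd isUnit_one hx
    | of_mul i w =>
      rw [Con.coe_mul, map_mul]
      refine Dvd.dvd.mul_right ?_ _
      fin_cases i
      · exact dvd_refl 2
      · exact dvd_zero 2

/-- The generator `a` of `B_n` is not a product of at least two non-units. -/
theorem length_lt_two_of_prod_eq_bA (n : ℕ) (hn : n ≠ 0) (l : List (Bn n))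
    (hl : ∀ u ∈ l, ¬ IsUnit u) (h : l.prod = bA n) : l.length < 2 := by
  match l, hl, h with
  | [], _, _ => simp
  | [_], _, _ => simp
  | x :: y :: t, hl, h =>
    exfalso
    obtain ⟨p, hp⟩ := two_dvd_bnToZMod n hn x (hl x (by simp))
    obtain ⟨q, hq⟩ := two_dvd_bnToZMod n hn y (hl y (by simp))
    have h2 := congrArg (bnToZMod n hn) h
    rw [List.prod_cons, List.prod_cons, map_mul, map_mul, hp, hq, bnToZMod_bA] at h2
    clear hp hq
    generalize bnToZMod n hn t.prod = r at h2
    revert h2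
    revert p q r
    decide

theorem not_isUnit_bB (n : ℕ) (hn : n ≠ 0) : ¬ IsUnit (bB n) := by
  intro h
  have h0 := h.map (bnToZMod n hn)
  rw [bnToZMod_bB] at h0
  revert h0
  rw [isUnit_zero_iff]
  decide

/-- For `n ≥ 3`, the monoid `B_n = ⟨a, b ∣ ba = b^n⟩` is not a
transfer Krull monoid: for every abelian group `G`, subset `G₀ ⊆ G` and monoid
homomorphism `θ : B_n → B(G₀)` into the monoid of zero-sum sequences over `G₀`,
`θ` is not a weak transfer homomorphism. -/
theorem statement8 {G : Type*} [AddCommGroup G] (n : ℕ) (hn : 3 ≤ n) (G₀ : Set G)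
    (θ : Bn n →* Multiplicative (ZeroSums G₀)) :
    ¬ IsWeakTransferHom θ := by
  rintro ⟨-, hunit, hfactor⟩
  have hn0 : n ≠ 0 := by omega
  have hb : ¬ IsUnit (θ (bB n)) := fun h => not_isUnit_bB n hn0 ((hunit _).mp h)
  obtain ⟨l, hl, hprod⟩ := monAtomic_zeroSums G₀ _ hb
  have hlen : 0 < l.length := by
    refine List.length_pos_iff.mpr fun h => hb ?_
    rw [← hprod, h]
    exact isUnit_one
  have hpow : θ (bA n) = θ (bB n) ^ (n - 1) := by
    have h := congrArg θ (bB_mul_bA n)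
    rw [map_mul, map_pow, ← mul_pow_sub_one hn0] at h
    exact mul_left_cancel h
  let m : List (Multiplicative (ZeroSums G₀)) := (List.replicate (n - 1) l).flatten
  have hm : ∀ u ∈ m, IsMonAtom u := by
    intro u hu
    obtain ⟨l', hl', hu'⟩ := List.mem_flatten.mp hu
    exact hl u (List.eq_of_mem_replicate hl' ▸ hu')
  have hmprod : m.prod = θ (bA n) := by
    simp [m, List.prod_flatten, hprod, hpow]
  have hmlen : 2 ≤ m.length := by
    have h : m.length = (n - 1) * l.length := by simp [m]
    rw [h]
    exact (show 2 ≤ n - 1 by omega).trans (Nat.le_mul_of_pos_right _ hlen)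
  obtain ⟨u, -, hu, hatom, -⟩ := hfactor (bA n) m.length m.get (by omega)
    (fun i => hm _ (List.get_mem m i)) (by rw [List.ofFn_get, hmprod])
  have hlt := length_lt_two_of_prod_eq_bA n hn0 (List.ofFn u) (fun x hx => by
    obtain ⟨i, rfl⟩ := List.mem_ofFn.mp hx
    exact (hatom i).1) hu.symm
  rw [List.length_ofFn] at hlt
  omega
end

section
/- Let H be a reduced atomic unit-cancellative finitely presented monoid with H ≠ {1}, say H = ⟨A(H) | x_1 = y_1, …, x_m = y_m⟩, and let d : ~_H → ℕ₀ be a distance on H. Then sup Δ(H) ≤ c_d(H) ≤ max{d(x_1, y_1), …, d(x_m, y_m)} < ∞. -/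
attribute [local instance] Classical.propDecidable

/-- The factorization monoid `Z(M)`: the free monoid on the set of atoms of `M`. -/
abbrev FacM (M : Type*) [Monoid M] := FreeMonoid {u : M // IsMonAtom u}

/-- The canonical epimorphism `π : Z(M) → M` mapping a formal word of atoms to
its product. -/
def facProd (M : Type*) [Monoid M] : FacM M →* M := FreeMonoid.lift Subtype.val

/-- The monoid of relations `~_M = {(x, y) ∈ Z(M) × Z(M) : π x = π y}`, as a
submonoid of `Z(M) × Z(M)`. -/
def relMonoid (M : Type*) [Monoid M] : Submonoid (FacM M × FacM M) where
  carrier := {p | facProd M p.1 = facProd M p.2}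
  one_mem' := by simp
  mul_mem' := by
    intro p q hp hq
    simp only [Set.mem_setOf_eq, Prod.fst_mul, Prod.snd_mul, map_mul] at *
    rw [hp, hq]
/-- A reduced atomic monoid is finitely presented if its set of atoms is finite
and the congruence `~_M` (the kernel of `π : Z(M) → M`) is generated, as a
congruence on `Z(M)`, by a finite set `R` of relations. -/
def IsFinitelyPresentedBy (M : Type*) [Monoid M]
    (R : Finset (FacM M × FacM M)) : Prop :=
  {u : M | IsMonAtom u}.Finite ∧
  (∀ p ∈ R, facProd M p.1 = facProd M p.2) ∧
  Con.ker (facProd M) = conGen (fun x y => (x, y) ∈ R)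
open scoped ENat

/-- `N` is a bound for the catenary degree of `x` (with respect to the distance
function `d`): any two factorizations of `x` can be joined by a chain of
factorizations of `x` with consecutive distances at most `N`. -/
def IsCatBound {M : Type*} [Monoid M] (d : FacM M → FacM M → ℕ) (x : M)
    (N : ℕ∞) : Prop :=
  ∀ z z' : FacM M, facProd M z = x → facProd M z' = x →
    ∃ c : List (FacM M), c.head? = some z ∧ c.getLast? = some z' ∧
      (∀ w ∈ c, facProd M w = x) ∧ c.Chain' (fun u v => (d u v : ℕ∞) ≤ N)

/-- The catenary degree `c_d(x) ∈ ℕ₀ ∪ {∞}` of an element `x`, with respect to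
the distance function `d`. -/
noncomputable def catDeg {M : Type*} [Monoid M] (d : FacM M → FacM M → ℕ)
    (x : M) : ℕ∞ :=
  sInf {N : ℕ∞ | IsCatBound d x N}

/-- The catenary degree `c_d(M) = sup {c_d(x) : x ∈ M}` of the monoid `M`. -/
noncomputable def catDegMon (M : Type*) [Monoid M]
    (d : FacM M → FacM M → ℕ) : ℕ∞ :=
  ⨆ x : M, catDeg d x
/-- A distance on `M`: a function `d` on pairs of factorizations which, on pairs
of factorizations of a common element, satisfies the axioms **(D1)**–**(D5)**. -/
def IsDistance (M : Type*) [Monoid M] (d : FacM M → FacM M → ℕ) : Prop :=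
  (∀ z, d z z = 0) ∧
  (∀ z z', facProd M z = facProd M z' → d z z' = d z' z) ∧
  (∀ z z' z'', facProd M z = facProd M z' → facProd M z = facProd M z'' →
    d z z' ≤ d z z'' + d z'' z') ∧
  (∀ x y z z', facProd M z = facProd M z' →
    d (x * z) (x * z') = d z z' ∧ d (z * y) (z' * y) = d z z') ∧
  (∀ z z', facProd M z = facProd M z' →
    ((z.length : ℤ) - (z'.length : ℤ)).natAbs ≤ d z z' ∧
      d z z' ≤ max (max z.length z'.length) 1)

/-- The set of distances `Δ(L)` of a set `L ⊆ ℕ₀`: all `d ∈ ℕ` such that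
`[ℓ, ℓ + d] ∩ L = {ℓ, ℓ + d}` for some `ℓ ∈ L`. -/
def deltaOfSet (L : Set ℕ) : Set ℕ :=
  {d | 0 < d ∧ ∃ ℓ ∈ L, ℓ + d ∈ L ∧
    ∀ j ∈ L, ℓ ≤ j → j ≤ ℓ + d → j = ℓ ∨ j = ℓ + d}

/-- The set of distances `Δ(M) = ⋃_{a ∈ M} Δ(L(a))` of a monoid `M`. -/
def deltaMon (M : Type*) [Monoid M] : Set ℕ :=
  ⋃ L ∈ LSystem M, deltaOfSet L
open scoped ENat

/-- The supremum of a set of naturals, computed in `ℕ∞`. -/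
noncomputable def natSetSup (L : Set ℕ) : ℕ∞ :=
  sSup ((fun t : ℕ => (t : ℕ∞)) '' L)

/-- `ρ_k(M) = sup U_k(M) ∈ ℕ∞`. -/
noncomputable def rhoK (M : Type*) [Monoid M] (k : ℕ) : ℕ∞ :=
  natSetSup (unionOfLengths M k)

/-- `P` is a (possibly infinite) arithmetical progression with difference `d`:
it is nonempty, any two of its elements are congruent modulo `d`, and it contains
every element between two of its elements which is congruent to them modulo `d`. -/
def IsAPWithDiff (d : ℕ) (P : Set ℕ) : Prop :=
  P.Nonempty ∧ (∀ x ∈ P, ∀ y ∈ P, x ≤ y → d ∣ y - x) ∧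
    ∀ x ∈ P, ∀ y ∈ P, ∀ z : ℕ, x ≤ z → z ≤ y → d ∣ z - x → z ∈ P

/-- `L` is an almost arithmetical progression (AAP) with difference `d` and
bound `B`: `L ⊆ min L + dℤ`, and `L ∩ [min L + B, sup L − B]` is a nonempty
arithmetical progression with difference `d`. -/
def IsAAP (d B : ℕ) (L : Set ℕ) : Prop :=
  L.Nonempty ∧ (∀ x ∈ L, d ∣ x - sInf L) ∧
    IsAPWithDiff d {y | y ∈ L ∧ sInf L + B ≤ y ∧ (y : ℕ∞) + B ≤ natSetSup L}

/-- The system of sets of lengths of `M` satisfies the Structure Theorem for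
Unions: there are `d ∈ ℕ` and `B ∈ ℕ₀` such that `U_k(M)` is an AAP with
difference `d` and bound `B` for all sufficiently large `k`. -/
def SatisfiesStructureThmForUnions (M : Type*) [Monoid M] : Prop :=
  ∃ d : ℕ, 0 < d ∧ ∃ B : ℕ, ∃ K : ℕ, ∀ k : ℕ, K ≤ k → IsAAP d B (unionOfLengths M k)

/-- The congruence on factorizations generated by steps of distance at most `N` along which
the product is constant. -/
def stepCon {M : Type*} [Monoid M] {d : FacM M → FacM M → ℕ} (hd : IsDistance M d) (N : ℕ∞) :
    Con (FacM M) where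
  r := Relation.ReflTransGen fun u v => facProd M u = facProd M v ∧ (d u v : ℕ∞) ≤ N
  iseqv := by
    refine ⟨fun _ => .refl, fun h => ?_, fun h₁ h₂ => h₁.trans h₂⟩
    induction h with
    | refl => exact .refl
    | @tail u v _ huv ih => exact .head ⟨huv.1.symm, (hd.2.1 u v huv.1) ▸ huv.2⟩ ih
  mul' := by
    intro w x y z hwx hyz
    refine (hwx.lift (· * y) fun u v huv => ?_).trans (hyz.lift (x * ·) fun u v huv => ?_)
    · exact ⟨by simp [huv.1], by rw [(hd.2.2.2.1 1 y u v huv.1).2]; exact huv.2⟩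
    · exact ⟨by simp [huv.1], by rw [(hd.2.2.2.1 x 1 u v huv.1).1]; exact huv.2⟩

theorem isCatBound_of_ker_le_stepCon {M : Type*} [Monoid M] {d : FacM M → FacM M → ℕ}
    (hd : IsDistance M d) {N : ℕ∞} (h : Con.ker (facProd M) ≤ stepCon hd N) (x : M) :
    IsCatBound d x N := by
  intro z z' hz hz'
  have hzz' : Relation.ReflTransGen
      (fun u v => facProd M u = facProd M v ∧ (d u v : ℕ∞) ≤ N) z z' :=
    h ((Con.ker_rel _).2 (hz.trans hz'.symm))
  clear hz'
  induction hzz' with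
  | refl => exact ⟨[z], by simp, by simp, by simp [hz], List.isChain_singleton z⟩
  | @tail u v _ huv ih =>
    obtain ⟨c, hhead, hlast, hmem, hchain⟩ := ih
    have hu : u ∈ c := List.mem_of_getLast? hlast
    refine ⟨c ++ [v], by simp [hhead], by simp, ?_, ?_⟩
    · intro w hw
      rcases List.mem_append.1 hw with hw | hw
      · exact hmem w hw
      · rw [List.mem_singleton.1 hw, ← huv.1, hmem u hu]
    · refine List.isChain_append.2 ⟨hchain, by simp, ?_⟩
      intro a ha b hb
      obtain rfl : u = a := by simpa [hlast] using ha
      obtain rfl : v = b := by simpa using hb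
      exact huv.2

theorem mem_setOfLengths_iff {M : Type*} [Monoid M] {x : M} (hx : x ≠ 1) {k : ℕ} :
    k ∈ setOfLengths x ↔ ∃ z : FacM M, facProd M z = x ∧ z.length = k := by
  rw [setOfLengths, if_neg hx]
  constructor
  · rintro ⟨l, rfl, hl, rfl⟩
    lift l to List {u : M // IsMonAtom u} using hl
    exact ⟨FreeMonoid.ofList l, by simp [facProd, FreeMonoid.lift_apply],
      by simp [FreeMonoid.length]⟩
  · rintro ⟨z, rfl, rfl⟩
    refine ⟨z.toList.map Subtype.val, by simp [FreeMonoid.length], ?_, by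
      simp [facProd, FreeMonoid.lift_apply]⟩
    intro u hu
    obtain ⟨a, -, rfl⟩ := List.mem_map.1 hu
    exact a.2

/-- A chain with steps of size at most `N`, avoiding the open interval `(ℓ, ℓ + t)`, and crossing
it, forces `t ≤ N`. -/
theorem le_of_isChain_crossing {α : Type*} {f : α → ℕ} {N : ℕ∞} {ℓ t : ℕ} {c : List α} {z z' : α}
    (hhead : c.head? = some z) (hlast : c.getLast? = some z')
    (hstep : c.IsChain fun u v => ((f v - f u : ℕ) : ℕ∞) ≤ N)
    (hgap : ∀ w ∈ c, f w ≤ ℓ ∨ ℓ + t ≤ f w) (hz : f z ≤ ℓ) (hz' : ℓ + t ≤ f z') :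
    (t : ℕ∞) ≤ N := by
  induction c generalizing z with
  | nil => simp at hhead
  | cons a c ih =>
    obtain rfl : a = z := by simpa using hhead
    cases c with
    | nil =>
      obtain rfl : a = z' := by simpa using hlast
      obtain rfl : t = 0 := by omega
      simp
    | cons b c =>
      rw [List.isChain_cons_cons] at hstep
      rcases hgap b (by simp) with hb | hb
      · exact ih rfl (by simpa using hlast) hstep.2
          (fun w hw => hgap w (List.mem_cons_of_mem _ hw)) hb
      · exact le_trans (by exact_mod_cast (by omega : t ≤ f b - f a)) hstep.1

theorem le_of_mem_deltaOfSet {M : Type*} [Monoid M] {d : FacM M → FacM M → ℕ}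
    (hd : IsDistance M d) {x : M} {t : ℕ} (ht : t ∈ deltaOfSet (setOfLengths x)) {N : ℕ∞}
    (hN : IsCatBound d x N) : (t : ℕ∞) ≤ N := by
  obtain ⟨htpos, ℓ, hℓ, hℓt, hgap⟩ := ht
  have hx : x ≠ 1 := by
    rintro rfl
    simp only [setOfLengths, if_true, Set.mem_singleton_iff] at hℓ hℓt
    omega
  obtain ⟨z, hz, hzl⟩ := (mem_setOfLengths_iff hx).1 hℓ
  obtain ⟨z', hz', hzl'⟩ := (mem_setOfLengths_iff hx).1 hℓt
  obtain ⟨zs, hhead, hlast, hmem, hchain⟩ := hN z z' hz hz'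
  refine le_of_isChain_crossing (f := FreeMonoid.length) hhead hlast ?_ ?_ hzl.le hzl'.ge
  · replace hchain := List.isChain_iff_getElem.1 hchain
    refine List.isChain_iff_getElem.2 ?_
    intro i hi
    refine le_trans ?_ (hchain i hi)
    have := (hd.2.2.2.2 zs[i] zs[i + 1]
      ((hmem _ (List.getElem_mem _)).trans (hmem _ (List.getElem_mem _)).symm)).1
    exact_mod_cast (by omega : zs[i + 1].length - zs[i].length ≤ d zs[i] zs[i + 1])
  · intro w hw
    have := hgap w.length ((mem_setOfLengths_iff hx).2 ⟨w, hmem w hw, rfl⟩)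
    omega

/-- Let `H ≠ {1}` be a reduced atomic unit-cancellative monoid,
finitely presented by the finite set of relations `R`, and let `d` be a distance
on `H`. Then `sup Δ(H) ≤ c_d(H) ≤ max {d(x,y) : (x,y) ∈ R} < ∞`. -/
theorem statement11 (H : Type*) [Monoid H] (hred : MonReduced H)
    (hatomic : MonAtomic H) (huc : UnitCancellative H) (hnt : ∃ a : H, a ≠ 1)
    (R : Finset (FacM H × FacM H)) (hfp : IsFinitelyPresentedBy H R)
    (d : FacM H → FacM H → ℕ) (hd : IsDistance H d) :
    natSetSup (deltaMon H) ≤ catDegMon H d ∧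
    catDegMon H d ≤ (R.sup (fun p => d p.1 p.2) : ℕ∞) := by
  refine ⟨?_, ?_⟩
  · refine sSup_le ?_
    rintro _ ⟨t, ht, rfl⟩
    simp only [deltaMon, LSystem, Set.mem_iUnion] at ht
    obtain ⟨_, ⟨x, rfl⟩, ht⟩ := ht
    exact le_iSup_of_le x (le_sInf fun N hN => le_of_mem_deltaOfSet hd ht hN)
  · refine iSup_le fun x => sInf_le (isCatBound_of_ker_le_stepCon hd ?_ x)
    rw [hfp.2.2]
    refine Con.conGen_le.2 fun u v huv => Relation.ReflTransGen.single ⟨hfp.2.1 _ huv, ?_⟩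
    exact Finset.le_sup (f := fun p : FacM H × FacM H => (d p.1 p.2 : ℕ∞)) huv
end

section
/- Let H be a reduced atomic unit-cancellative finitely presented monoid with H ≠ {1}, say H = ⟨A(H) | x_1 = y_1, …, x_m = y_m⟩, and let d : ~_H → ℕ₀ be a distance on H. If c_d(π(x_i)) ≥ d(x_i, y_i) for every i ∈ [1,m], then c_d(H) = max{d(x_1, y_1), …, d(x_m, y_m)}. -/
attribute [local instance] Classical.propDecidable

open scoped ENat

/-- One step of a chain of factorizations of a common element, of distance at most `N`. -/
def CatStep {M : Type*} [Monoid M] (d : FacM M → FacM M → ℕ) (N : ℕ∞) (u v : FacM M) : Prop :=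
  facProd M u = facProd M v ∧ (d u v : ℕ∞) ≤ N

theorem CatStep.symm {M : Type*} [Monoid M] {d : FacM M → FacM M → ℕ} (hd : IsDistance M d)
    {N : ℕ∞} {u v : FacM M} (h : CatStep d N u v) : CatStep d N v u :=
  ⟨h.1.symm, hd.2.1 u v h.1 ▸ h.2⟩

theorem CatStep.mul_left {M : Type*} [Monoid M] {d : FacM M → FacM M → ℕ}
    (hd : IsDistance M d) {N : ℕ∞} {u v : FacM M} (x : FacM M) (h : CatStep d N u v) :
    CatStep d N (x * u) (x * v) :=
  ⟨by rw [map_mul, map_mul, h.1], by rw [(hd.2.2.2.1 x 1 u v h.1).1]; exact h.2⟩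

theorem CatStep.mul_right {M : Type*} [Monoid M] {d : FacM M → FacM M → ℕ}
    (hd : IsDistance M d) {N : ℕ∞} {u v : FacM M} (y : FacM M) (h : CatStep d N u v) :
    CatStep d N (u * y) (v * y) :=
  ⟨by rw [map_mul, map_mul, h.1], by rw [(hd.2.2.2.1 1 y u v h.1).2]; exact h.2⟩

/-- The congruence of being joined by a chain of factorizations with consecutive distances
at most `N`. -/
def catCon {M : Type*} [Monoid M] {d : FacM M → FacM M → ℕ} (hd : IsDistance M d) (N : ℕ∞) :
    Con (FacM M) where
  r := Relation.ReflTransGen (CatStep d N)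
  iseqv :=
    ⟨fun _ => .refl,
      fun h => by
        induction h with
        | refl => exact .refl
        | tail _ hbc ih => exact .head (hbc.symm hd) ih,
      fun h h' => h.trans h'⟩
  mul' {_ x y _} h h' :=
    (h.lift (· * y) fun _ _ hs => hs.mul_right hd y).trans
      (h'.lift (x * ·) fun _ _ hs => hs.mul_left hd x)

theorem exists_chain_of_catStep {M : Type*} [Monoid M] {d : FacM M → FacM M → ℕ} {N : ℕ∞}
    {z z' : FacM M} (h : Relation.ReflTransGen (CatStep d N) z z') :
    ∃ c : List (FacM M), c.head? = some z ∧ c.getLast? = some z' ∧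
      (∀ w ∈ c, facProd M w = facProd M z') ∧ c.IsChain (fun u v => (d u v : ℕ∞) ≤ N) := by
  induction h using Relation.ReflTransGen.head_induction_on with
  | refl => exact ⟨[z'], by simp⟩
  | head hs _ ih =>
    obtain ⟨c, hhead, hlast, hprod, hchain⟩ := ih
    obtain ⟨l, rfl⟩ : ∃ l, c = _ :: l := List.head?_eq_some_iff.mp hhead
    refine ⟨_ :: _ :: l, rfl, by simpa using hlast, ?_, .cons_cons hs.2 hchain⟩
    intro w hw
    rcases List.mem_cons.mp hw with rfl | hw
    · exact hs.1.trans (hprod _ List.mem_cons_self)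
    · exact hprod w hw

/-- Let `H ≠ {1}` be a reduced atomic unit-cancellative monoid,
finitely presented by the finite set of relations `R`, and let `d` be a distance
on `H`. If `c_d(π(x)) ≥ d(x, y)` for every relation `(x, y) ∈ R`, then
`c_d(H) = max {d(x, y) : (x, y) ∈ R}`. -/
theorem statement12 (H : Type*) [Monoid H] (hred : MonReduced H)
    (hatomic : MonAtomic H) (huc : UnitCancellative H) (hnt : ∃ a : H, a ≠ 1)
    (R : Finset (FacM H × FacM H)) (hfp : IsFinitelyPresentedBy H R)
    (d : FacM H → FacM H → ℕ) (hd : IsDistance H d)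
    (hcat : ∀ p ∈ R, (d p.1 p.2 : ℕ∞) ≤ catDeg d (facProd H p.1)) :
    catDegMon H d = (R.sup (fun p => d p.1 p.2) : ℕ∞) := by
  set N : ℕ∞ := R.sup (fun p => (d p.1 p.2 : ℕ∞))
  have hker : Con.ker (facProd H) ≤ catCon hd N := by
    rw [hfp.2.2]
    exact Con.conGen_le.mpr fun x y hxy => Relation.ReflTransGen.single
      ⟨hfp.2.1 _ hxy, Finset.le_sup (f := fun p => (d p.1 p.2 : ℕ∞)) hxy⟩
  apply le_antisymm
  · refine iSup_le fun x => sInf_le fun z z' hz hz' => ?_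
    obtain rfl := hz'
    exact exists_chain_of_catStep (hker hz)
  · exact Finset.sup_le fun p hp => (hcat p hp).trans (le_iSup (catDeg d) (facProd H p.1))
end

section
/- Let H ≠ {1} be a reduced atomic unit-cancellative monoid such that there exists L ∈ 𝓛(H) with ρ(L) = ρ(H) < ∞ (accepted elasticity). Then there is a bound M ∈ ℕ such that ρ_k(H) < ∞ and ρ_k(H) − ρ_{k−1}(H) ≤ M for all k ∈ ℕ with k ≥ 2. -/
attribute [local instance] Classical.propDecidable

open scoped ENNReal

open scoped ENat

theorem MonReduced.eq_one_of_mul_eq_one {H : Type*} [Monoid H] (hred : MonReduced H)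
    (huc : UnitCancellative H) {a b : H} (h : a * b = 1) : a = 1 ∧ b = 1 := by
  have hba : b * a = 1 := hred _ (huc.1 a (b * a) (by rw [← mul_assoc, h, one_mul]))
  exact ⟨hred a ⟨⟨a, b, h, hba⟩, rfl⟩,
    hred b ⟨⟨b, a, hba, h⟩, rfl⟩⟩

theorem eq_nil_of_atoms_prod_eq_one {H : Type*} [Monoid H] (hred : MonReduced H)
    (huc : UnitCancellative H) {l : List H} (hl : ∀ u ∈ l, IsMonAtom u) (h : l.prod = 1) :
    l = [] := by
  cases l with
  | nil => rfl
  | cons u l =>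
    rw [List.prod_cons] at h
    exact ((hl u (by simp)).1
      ((hred.eq_one_of_mul_eq_one huc h).1 ▸ isUnit_one)).elim

theorem mem_setOfLengths_iff_s14 {H : Type*} [Monoid H] (hred : MonReduced H)
    (huc : UnitCancellative H) {x : H} {k : ℕ} :
    k ∈ setOfLengths x ↔ ∃ l : List H, l.length = k ∧ (∀ u ∈ l, IsMonAtom u) ∧ l.prod = x := by
  unfold setOfLengths
  split_ifs with hx
  · subst hx
    constructor
    · rintro rfl
      exact ⟨[], by simp⟩
    · rintro ⟨l, rfl, hl, hp⟩
      simp [eq_nil_of_atoms_prod_eq_one hred huc hl hp]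
  · rfl

theorem add_mem_setOfLengths_mul {H : Type*} [Monoid H] (hred : MonReduced H)
    (huc : UnitCancellative H) {x y : H} {k m : ℕ} (hk : k ∈ setOfLengths x)
    (hm : m ∈ setOfLengths y) : k + m ∈ setOfLengths (x * y) := by
  rw [mem_setOfLengths_iff_s14 hred huc] at *
  obtain ⟨l, rfl, hl, rfl⟩ := hk
  obtain ⟨l', rfl, hl', rfl⟩ := hm
  refine ⟨l ++ l', by simp, ?_, by simp⟩
  intro u hu
  exact (List.mem_append.1 hu).elim (hl u) (hl' u)

theorem mul_mem_setOfLengths_pow {H : Type*} [Monoid H] (hred : MonReduced H)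
    (huc : UnitCancellative H) {x : H} {k : ℕ} (hk : k ∈ setOfLengths x) (j : ℕ) :
    j * k ∈ setOfLengths (x ^ j) := by
  induction j with
  | zero => simp [setOfLengths]
  | succ j ih =>
    rw [pow_succ, add_mul, one_mul]
    exact add_mem_setOfLengths_mul hred huc ih hk

theorem one_mem_setOfLengths {H : Type*} [Monoid H] (hred : MonReduced H)
    (huc : UnitCancellative H) {u : H} (hu : IsMonAtom u) : 1 ∈ setOfLengths u :=
  (mem_setOfLengths_iff_s14 hred huc).2 ⟨[u], by simpa using hu⟩

theorem exists_isMonAtom {H : Type*} [Monoid H] (hred : MonReduced H)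
    (hatomic : MonAtomic H) (hnt : ∃ a : H, a ≠ 1) : ∃ u : H, IsMonAtom u := by
  obtain ⟨a, ha⟩ := hnt
  obtain ⟨l, hl, rfl⟩ := hatomic a fun h => ha (hred a h)
  cases l with
  | nil => simp at ha
  | cons u l => exact ⟨u, hl u (by simp)⟩

theorem le_setElasticity_mul {L : Set ℕ} {k t : ℕ} (hk : k ∈ L) (ht : t ∈ L) (hk0 : k ≠ 0) :
    (t : ℝ≥0∞) ≤ setElasticity L * k := by
  rcases eq_or_ne t 0 with rfl | ht0
  · simp
  have hkL : k ∈ L \ {0} := ⟨hk, hk0⟩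
  rw [← ENNReal.div_le_iff (by simpa using hk0) (ENNReal.natCast_ne_top k), setElasticity,
    if_pos ⟨k, hkL⟩]
  exact ENNReal.div_le_div (le_sSup ⟨t, ⟨ht, ht0⟩, rfl⟩) (by exact_mod_cast Nat.sInf_le hkL)

theorem exists_natCast_eq_setElasticity_mul {L : Set ℕ} (hL : (L \ {0}).Nonempty)
    (hfin : setElasticity L < ⊤) :
    ∃ m ∈ L, ∃ n ∈ L, m ≠ 0 ∧ n ≠ 0 ∧ (n : ℝ≥0∞) = setElasticity L * m := by
  have hm := Nat.sInf_mem hL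
  set m := sInf (L \ {0}) with hmdef
  have hm0 : (m : ℝ≥0∞) ≠ 0 := by simpa using hm.2
  have hsup : setElasticity L * m = sSup ((fun k : ℕ => (k : ℝ≥0∞)) '' (L \ {0})) := by
    rw [setElasticity, if_pos hL, ← hmdef, ENNReal.div_mul_cancel hm0 (ENNReal.natCast_ne_top m)]
  have htop : setElasticity L * m < ⊤ := ENNReal.mul_lt_top hfin (ENNReal.natCast_lt_top m)
  obtain ⟨N, hN⟩ := ENNReal.exists_nat_gt htop.ne
  have hbdd : BddAbove (L \ {0}) := by
    refine ⟨N, fun t ht => ?_⟩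
    have : (t : ℝ≥0∞) ≤ setElasticity L * m := hsup ▸ le_sSup ⟨t, ht, rfl⟩
    exact_mod_cast this.trans hN.le
  have hn := Nat.sSup_mem hL hbdd
  refine ⟨m, hm.1, _, hn.1, hm.2, hn.2, hsup ▸ le_antisymm (le_sSup ⟨_, hn, rfl⟩) ?_⟩
  refine sSup_le ?_
  rintro _ ⟨t, ht, rfl⟩
  exact Nat.cast_le.2 (le_csSup hbdd ht)

theorem AcceptedElasticity.exists_lengths {H : Type*} [Monoid H] (hred : MonReduced H)
    (hatomic : MonAtomic H) (huc : UnitCancellative H)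
    (hnt : ∃ a : H, a ≠ 1) (hacc : AcceptedElasticity H) :
    ∃ x : H, ∃ m ∈ setOfLengths x, ∃ n ∈ setOfLengths x,
      m ≠ 0 ∧ n ≠ 0 ∧ (n : ℝ≥0∞) = monElasticity H * m := by
  obtain ⟨_, ⟨x, rfl⟩, hx, hfin⟩ := hacc
  by_cases hL : (setOfLengths x \ {0}).Nonempty
  · rw [← hx] at hfin ⊢
    exact ⟨x, exists_natCast_eq_setElasticity_mul hL hfin⟩
  · obtain ⟨u, hu⟩ := exists_isMonAtom hred hatomic hnt
    have h1 := one_mem_setOfLengths hred huc hu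
    refine ⟨u, 1, h1, 1, h1, one_ne_zero, one_ne_zero, ?_⟩
    rw [← hx, setElasticity, if_neg hL]
    simp

theorem natCast_le_rhoK {H : Type*} [Monoid H] {x : H} {k t : ℕ} (hk : k ∈ setOfLengths x)
    (ht : t ∈ setOfLengths x) : (t : ℕ∞) ≤ rhoK H k :=
  le_sSup ⟨t, ⟨_, ⟨⟨x, rfl⟩, hk⟩, ht⟩, rfl⟩

theorem rhoK_le_of_monElasticity_mul_le {H : Type*} [Monoid H] {k N : ℕ} (hk : k ≠ 0)
    (hN : monElasticity H * k ≤ N) : rhoK H k ≤ N := by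
  refine sSup_le ?_
  rintro _ ⟨t, ⟨_, ⟨⟨x, rfl⟩, hkx⟩, htx⟩, rfl⟩
  have h : setElasticity (setOfLengths x) ≤ monElasticity H := le_sSup ⟨_, ⟨x, rfl⟩, rfl⟩
  have : (t : ℝ≥0∞) ≤ N :=
    (le_setElasticity_mul hkx htx hk).trans ((by gcongr : _ ≤ monElasticity H * k).trans hN)
  exact Nat.cast_le.2 (Nat.cast_le.1 this)

/-- Let `H ≠ {1}` be a reduced atomic unit-cancellative monoid
with accepted elasticity. Then there is a bound `M ∈ ℕ` such that `ρ_k(H) < ∞`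
and `ρ_k(H) − ρ_{k−1}(H) ≤ M` for all `k ≥ 2`. -/
theorem statement14 (H : Type*) [Monoid H] (hred : MonReduced H)
    (hatomic : MonAtomic H) (huc : UnitCancellative H)
    (hnt : ∃ a : H, a ≠ 1) (hacc : AcceptedElasticity H) :
    ∃ M : ℕ, 0 < M ∧ ∀ k : ℕ, 2 ≤ k →
      rhoK H k < ⊤ ∧ rhoK H k - rhoK H (k - 1) ≤ (M : ℕ∞) := by
  obtain ⟨x, m, hm, n, hn, hm0, hn0, hnm⟩ := hacc.exists_lengths hred hatomic huc hnt
  obtain ⟨u, hu⟩ := exists_isMonAtom hred hatomic hnt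
  refine ⟨n, Nat.pos_of_ne_zero hn0, fun k hk => ?_⟩
  set j := (k - 1) / m
  set r := (k - 1) % m
  have hdiv : j * m + r = k - 1 := Nat.div_add_mod' _ _
  have hr : r < m := Nat.mod_lt _ (Nat.pos_of_ne_zero hm0)
  have hpow {t : ℕ} (ht : t ∈ setOfLengths x) : j * t + r ∈ setOfLengths (x ^ j * u ^ r) := by
    simpa using add_mem_setOfLengths_mul hred huc (mul_mem_setOfLengths_pow hred huc ht j)
      (mul_mem_setOfLengths_pow hred huc (one_mem_setOfLengths hred huc hu) r)
  have hlow : ((j * n + r : ℕ) : ℕ∞) ≤ rhoK H (k - 1) :=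
    natCast_le_rhoK (hdiv ▸ hpow hm) (hpow hn)
  have hup : rhoK H k ≤ ((j + 1) * n : ℕ) := by
    refine rhoK_le_of_monElasticity_mul_le (by omega) ?_
    have hkm : k ≤ (j + 1) * m := by rw [add_mul]; omega
    calc monElasticity H * k ≤ monElasticity H * ((j + 1) * m : ℕ) := by gcongr
      _ = ((j + 1) * n : ℕ) := by push_cast; rw [hnm]; ring
  refine ⟨hup.trans_lt (ENat.natCast_lt_top _), tsub_le_iff_right.2 (hup.trans ?_)⟩
  calc (((j + 1) * n : ℕ) : ℕ∞) ≤ ((n + (j * n + r) : ℕ) : ℕ∞) := by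
        norm_cast; rw [add_mul]; omega
    _ = n + ((j * n + r : ℕ) : ℕ∞) := by push_cast; rfl
    _ ≤ n + rhoK H (k - 1) := by gcongr
end
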